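/- Let p be a prime, let s ≥ 1 be an integer, and set n = sp−1. Then 4 times the number of pairs (i,j) of nonnegative integers with i+j ≤ n−3 that are not Fermat-admissible for n and p equals s(s−1)p(p−1). (Equivalently, the a-number of the Fermat curve F_{sp−1} is a(F_{sp−1}) = s(s−1)p(p−1)/4.) -/

import Mathlib

/-- A pair `(i, j)` is *Fermat-admissible* for `n` and `p` if there exist integers
`h, k` with `0 ≤ h ≤ p - 1` and `0 ≤ k ≤ h` such that `n*(p-1-h) + i ≡ p-1 (mod p)`
and `n*k + j ≡ p-1 (mod p)`. -/
def FermatAdmissible (n p i j : ℕ) : Prop :=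
  ∃ h k : ℕ, h ≤ p - 1 ∧ k ≤ h ∧
    n * (p - 1 - h) + i ≡ p - 1 [MOD p] ∧ n * k + j ≡ p - 1 [MOD p]

theorem mul_add_modEq_sub_one_iff {n p c i : ℕ} (hp : 0 < p) (hn : p ∣ n + 1) (hc : c < p) :
    n * c + i ≡ p - 1 [MOD p] ↔ (i + 1) % p = c := by
  have key : n * c + i + (c + 1) ≡ i + 1 [MOD p] := by
    have h : n * c + i + (c + 1) = (n + 1) * c + (i + 1) := by ring
    rw [h]
    simpa using (Nat.modEq_zero_iff_dvd.2 (hn.mul_right c)).add_right (i + 1)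
  have hpc : p - 1 + (c + 1) ≡ c [MOD p] := by
    have h : p - 1 + (c + 1) = p + c := by omega
    rw [h]
    simp [Nat.ModEq]
  rw [← Nat.ModEq.add_iff_right (Nat.ModEq.refl (c + 1) : c + 1 ≡ c + 1 [MOD p])]
  constructor
  · intro h
    have := (key.symm.trans h).trans hpc
    rwa [Nat.ModEq, Nat.mod_eq_of_lt hc] at this
  · intro h
    refine key.trans (Nat.ModEq.trans ?_ hpc.symm)
    rwa [Nat.ModEq, Nat.mod_eq_of_lt hc]

theorem fermatAdmissible_iff {n p i j : ℕ} (hp : 0 < p) (hn : p ∣ n + 1) :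
    FermatAdmissible n p i j ↔ (i + 1) % p + (j + 1) % p < p := by
  constructor
  · rintro ⟨h, k, hh, hk, h1, h2⟩
    rw [mul_add_modEq_sub_one_iff hp hn (by omega)] at h1 h2
    omega
  · intro h
    refine ⟨p - 1 - (i + 1) % p, (j + 1) % p, by omega, by omega, ?_, ?_⟩ <;>
      rw [mul_add_modEq_sub_one_iff hp hn (by omega)]
    omega

/-- The lattice points `(x, y)` of the triangle `x + y + 2 ≤ m`. -/
def latticeTriangle (m : ℕ) : Finset (ℕ × ℕ) :=
  (Finset.range (m - 1)).biUnion Finset.HasAntidiagonal.antidiagonal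

theorem mem_latticeTriangle {m : ℕ} {x : ℕ × ℕ} :
    x ∈ latticeTriangle m ↔ x.1 + x.2 + 2 ≤ m := by
  simp only [latticeTriangle, Finset.mem_biUnion, Finset.mem_range, Finset.HasAntidiagonal.mem_antidiagonal,
    exists_eq_right']
  omega

theorem two_mul_card_latticeTriangle (m : ℕ) :
    2 * (latticeTriangle m).card = m * (m - 1) := by
  rw [latticeTriangle, Finset.card_biUnion]
  · cases m with
    | zero => simp
    | succ m =>
      have h := Finset.sum_range_id_mul_two (m + 1)
      rw [Finset.sum_range_succ'] at h
      simp only [Finset.Nat.card_antidiagonal]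
      simp at h ⊢
      omega
  · intro a _ b _ hab
    rw [Function.onFun, Finset.disjoint_left]
    intro x hx hy
    rw [Finset.HasAntidiagonal.mem_antidiagonal] at hx hy
    exact hab (hx.symm.trans hy)

theorem setOf_not_fermatAdmissible_eq_image {p s n : ℕ} (hp : 0 < p) (hn : n + 1 = s * p) :
    {ij : ℕ × ℕ | (ij.1 : ℤ) + ij.2 ≤ (n : ℤ) - 3 ∧ ¬ FermatAdmissible n p ij.1 ij.2} =
      (fun t : (ℕ × ℕ) × (ℕ × ℕ) ↦ (p * t.1.1 + (p - 2 - t.2.1), p * t.1.2 + (p - 2 - t.2.2))) ''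
        (latticeTriangle s ×ˢ latticeTriangle p : Finset _) := by
  ext ⟨i, j⟩
  simp only [Set.mem_ofPred_eq, Set.mem_image, Finset.mem_coe, Finset.mem_product,
    mem_latticeTriangle, fermatAdmissible_iff hp (hn ▸ dvd_mul_left p s), Prod.exists,
    Prod.mk.injEq]
  constructor
  · rintro ⟨hle, hadm⟩
    have hi := Nat.div_add_mod (i + 1) p
    have hj := Nat.div_add_mod (j + 1) p
    have hi' := Nat.mod_lt (i + 1) hp
    have hj' := Nat.mod_lt (j + 1) hp
    refine ⟨(i + 1) / p, (j + 1) / p, p - 1 - (i + 1) % p, p - 1 - (j + 1) % p,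
      ⟨?_, by omega⟩, by omega, by omega⟩
    have h : p * ((i + 1) / p + (j + 1) / p + 1) < p * s := by
      rw [mul_comm p s, ← hn, mul_add, mul_add]
      omega
    have := Nat.lt_of_mul_lt_mul_left h
    omega
  · rintro ⟨I, J, x, y, ⟨hIJ, hxy⟩, rfl, rfl⟩
    have hmod (I x : ℕ) (hx : x + 2 ≤ p) : (p * I + (p - 2 - x) + 1) % p = p - 1 - x := by
      have h : p * I + (p - 2 - x) + 1 = p * I + (p - 1 - x) := by omega
      rw [h, Nat.mul_add_mod, Nat.mod_eq_of_lt (by omega)]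
    rw [hmod I x (by omega), hmod J y (by omega)]
    have h := Nat.mul_le_mul_left p hIJ
    rw [mul_comm p s, ← hn, mul_add, mul_add] at h
    refine ⟨?_, by omega⟩
    have : p * I + (p - 2 - x) + (p * J + (p - 2 - y)) + 3 ≤ n := by omega
    omega

theorem injOn_latticeTriangle_product (p s : ℕ) :
    Set.InjOn
      (fun t : (ℕ × ℕ) × (ℕ × ℕ) ↦ (p * t.1.1 + (p - 2 - t.2.1), p * t.1.2 + (p - 2 - t.2.2)))
      (latticeTriangle s ×ˢ latticeTriangle p : Finset _) := by
  have key {I x I' x' : ℕ} (hx : x + 2 ≤ p) (hx' : x' + 2 ≤ p)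
      (h : p * I + (p - 2 - x) = p * I' + (p - 2 - x')) : I = I' ∧ x = x' := by
    have hmod := congrArg (· % p) h
    simp only [Nat.mul_add_mod] at hmod
    rw [Nat.mod_eq_of_lt (by omega), Nat.mod_eq_of_lt (by omega)] at hmod
    exact ⟨Nat.eq_of_mul_eq_mul_left (by omega : 0 < p) (by omega), by omega⟩
  rintro ⟨⟨I, J⟩, x, y⟩ ht ⟨⟨I', J'⟩, x', y'⟩ ht' h
  simp only [Finset.mem_coe, Finset.mem_product, mem_latticeTriangle] at ht ht'
  simp only [Prod.mk.injEq] at h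
  obtain ⟨rfl, rfl⟩ := key (by omega) (by omega) h.1
  obtain ⟨rfl, rfl⟩ := key (by omega) (by omega) h.2
  rfl

/-- The `a`-number of the Fermat curve `F_{sp-1}` is `s*(s-1)*p*(p-1)/4`. -/
theorem four_mul_card_not_fermatAdmissible_sp_sub_one
    (p s n : ℕ) (hp : p.Prime) (hs : 1 ≤ s) (hn : n = s * p - 1) :
    4 * {ij : ℕ × ℕ | (ij.1 : ℤ) + ij.2 ≤ (n : ℤ) - 3 ∧
          ¬ FermatAdmissible n p ij.1 ij.2}.ncard
      = s * (s - 1) * p * (p - 1) := by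
  have hsp : 0 < s * p := Nat.mul_pos hs hp.pos
  rw [setOf_not_fermatAdmissible_eq_image hp.pos (by omega : n + 1 = s * p),
    (injOn_latticeTriangle_product p s).ncard_image, Set.ncard_coe_finset,
    Finset.card_product]
  calc _ = (2 * (latticeTriangle s).card) * (2 * (latticeTriangle p).card) := by ring
    _ = _ := by rw [two_mul_card_latticeTriangle, two_mul_card_latticeTriangle]; ring
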